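/- arXiv:2605.05521 — 6 statements merged into one kernel-verified Lean document; each statement's English description precedes it below -/
import Mathlib

section
/- Let Z be a finite nonempty type and let ≿ be a binary relation on lotteries on Z. The following are equivalent: (1) ≿ satisfies Completeness, Transitivity, Independence and Continuity; (2) there exists a utility function u : Z → ℝ that represents ≿ (i.e., p ≿ q iff E_p[u] ≥ E_q[u] for all lotteries p, q). Moreover, any two utility functions u, u' representing the same relation ≿ satisfying these axioms are related by a positive affine transformation: there exist a > 0 and b ∈ ℝ with u'(z) = a·u(z) + b for all z ∈ Z. -/
/-- `p` is a lottery on the finite type `Z`. -/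
def IsLottery {Z : Type*} [Fintype Z] (p : Z → ℝ) : Prop :=
  (∀ z, 0 ≤ p z) ∧ ∑ z, p z = 1

/-- Expected utility of lottery `p` under utility `u`. -/
noncomputable def expUtil {Z : Type*} [Fintype Z] (u p : Z → ℝ) : ℝ :=
  ∑ z, u z * p z

/-- Mixture `α p + (1 - α) q`. -/
def mix {Z : Type*} (α : ℝ) (p q : Z → ℝ) : Z → ℝ :=
  fun z => α * p z + (1 - α) * q z

/-- `u` represents the relation `R` on lotteries. -/
def Represents {Z : Type*} [Fintype Z]
    (R : (Z → ℝ) → (Z → ℝ) → Prop) (u : Z → ℝ) : Prop :=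
  ∀ p q : Z → ℝ, IsLottery p → IsLottery q → (R p q ↔ expUtil u p ≥ expUtil u q)

/-- Strict preference `p ≻ q`. -/
def StrictPref {Z : Type*} (R : (Z → ℝ) → (Z → ℝ) → Prop) (p q : Z → ℝ) : Prop :=
  R p q ∧ ¬ R q p

/-- Completeness on lotteries. -/
def CompleteAx {Z : Type*} [Fintype Z] (R : (Z → ℝ) → (Z → ℝ) → Prop) : Prop :=
  ∀ p q : Z → ℝ, IsLottery p → IsLottery q → (R p q ∨ R q p)

/-- Transitivity on lotteries. -/
def TransitiveAx {Z : Type*} [Fintype Z] (R : (Z → ℝ) → (Z → ℝ) → Prop) : Prop :=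
  ∀ p q r : Z → ℝ, IsLottery p → IsLottery q → IsLottery r → R p q → R q r → R p r

/-- vNM Independence on lotteries. -/
def IndependenceAx {Z : Type*} [Fintype Z] (R : (Z → ℝ) → (Z → ℝ) → Prop) : Prop :=
  ∀ p q r : Z → ℝ, IsLottery p → IsLottery q → IsLottery r →
    ∀ α : ℝ, 0 < α → α ≤ 1 →
      StrictPref R p q → StrictPref R (mix α p r) (mix α q r)

/-- vNM Continuity on lotteries. -/
def ContinuityAx {Z : Type*} [Fintype Z] (R : (Z → ℝ) → (Z → ℝ) → Prop) : Prop :=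
  ∀ p q r : Z → ℝ, IsLottery p → IsLottery q → IsLottery r →
    StrictPref R p q → StrictPref R q r →
      ∃ α β : ℝ, 0 < α ∧ α < 1 ∧ 0 < β ∧ β < 1 ∧
        StrictPref R (mix α p r) q ∧ StrictPref R q (mix β p r)

section Lotteries

variable {Z : Type*} [Fintype Z]

theorem IsLottery.mix {p q : Z → ℝ} (hp : IsLottery p) (hq : IsLottery q) {α : ℝ}
    (h0 : 0 ≤ α) (h1 : α ≤ 1) : IsLottery (mix α p q) := by
  refine ⟨fun z => ?_, ?_⟩
  · have := mul_nonneg h0 (hp.1 z)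
    have := mul_nonneg (sub_nonneg.2 h1) (hq.1 z)
    simp only [_root_.mix]
    linarith
  · simp only [_root_.mix, Finset.sum_add_distrib, ← Finset.mul_sum, hp.2, hq.2]
    ring

theorem isLottery_single [DecidableEq Z] (z : Z) : IsLottery (Pi.single z (1 : ℝ)) :=
  single_mem_stdSimplex ℝ z

theorem expUtil_single [DecidableEq Z] (u : Z → ℝ) (z : Z) :
    expUtil u (Pi.single z (1 : ℝ)) = u z := by
  simp [expUtil, Pi.single_apply]

theorem expUtil_mix (u p q : Z → ℝ) (α : ℝ) :
    expUtil u (mix α p q) = α * expUtil u p + (1 - α) * expUtil u q := by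
  simp only [expUtil, mix, Finset.mul_sum, ← Finset.sum_add_distrib]
  exact Finset.sum_congr rfl fun z _ => by ring

theorem expUtil_mem_Icc {u p : Z → ℝ} (hp : IsLottery p) (hu : ∀ z, u z ∈ Set.Icc (0 : ℝ) 1) :
    expUtil u p ∈ Set.Icc (0 : ℝ) 1 := by
  refine ⟨Finset.sum_nonneg fun z _ => mul_nonneg (hu z).1 (hp.1 z), ?_⟩
  rw [← hp.2]
  exact Finset.sum_le_sum fun z _ => mul_le_of_le_one_left (hp.1 z) (hu z).2

end Lotteries

section Mix

variable {Z : Type*}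

theorem mix_zero (p q : Z → ℝ) : mix 0 p q = q := by
  funext z; simp [mix]

theorem mix_one (p q : Z → ℝ) : mix 1 p q = p := by
  funext z; simp [mix]

theorem mix_self (α : ℝ) (p : Z → ℝ) : mix α p p = p := by
  funext z; simp only [mix]; ring

theorem mix_comm (α : ℝ) (p q : Z → ℝ) : mix α p q = mix (1 - α) q p := by
  funext z; simp only [mix]; ring

theorem mix_mix (α s t : ℝ) (p q : Z → ℝ) :
    mix α (mix s p q) (mix t p q) = mix (α * s + (1 - α) * t) p q := by
  funext z; simp only [mix]; ring

theorem mix_mix_left (α s : ℝ) (p q : Z → ℝ) :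
    mix α (mix s p q) q = mix (α * s) p q := by
  funext z; simp only [mix]; ring

end Mix

/-- The four von Neumann–Morgenstern axioms, bundled. -/
structure VNMAxioms {Z : Type*} [Fintype Z] (R : (Z → ℝ) → (Z → ℝ) → Prop) : Prop where
  complete : CompleteAx R
  trans : TransitiveAx R
  indep : IndependenceAx R
  cont : ContinuityAx R

namespace VNMAxioms

variable {Z : Type*} [Fintype Z] {R : (Z → ℝ) → (Z → ℝ) → Prop} {p q r : Z → ℝ}

/-- The axioms are invariant under reversing the preference. -/
theorem swap (h : VNMAxioms R) : VNMAxioms (fun p q => R q p) where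
  complete p q hp hq := h.complete q p hq hp
  trans p q r hp hq hr h1 h2 := h.trans r q p hr hq hp h2 h1
  indep p q r hp hq hr α h0 h1 hpq := h.indep q p r hq hp hr α h0 h1 hpq
  cont p q r hp hq hr hpq hqr := by
    obtain ⟨α, β, hα0, hα1, hβ0, hβ1, h1, h2⟩ := h.cont r q p hr hq hp hqr hpq
    rw [mix_comm] at h1 h2
    exact ⟨1 - β, 1 - α, by linarith, by linarith, by linarith, by linarith, h2, h1⟩

theorem refl (h : VNMAxioms R) (hp : IsLottery p) : R p p :=
  (h.complete p p hp hp).elim id id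

theorem strict_of_not (h : VNMAxioms R) (hp : IsLottery p) (hq : IsLottery q)
    (hpq : ¬ R p q) : StrictPref R q p :=
  ⟨(h.complete p q hp hq).resolve_left hpq, hpq⟩

theorem strict_trans_weak (h : VNMAxioms R) (hp : IsLottery p) (hq : IsLottery q)
    (hr : IsLottery r) (hpq : StrictPref R p q) (hqr : R q r) : StrictPref R p r :=
  ⟨h.trans p q r hp hq hr hpq.1 hqr, fun hrp => hpq.2 (h.trans q r p hq hr hp hqr hrp)⟩

theorem weak_trans_strict (h : VNMAxioms R) (hp : IsLottery p) (hq : IsLottery q)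
    (hr : IsLottery r) (hpq : R p q) (hqr : StrictPref R q r) : StrictPref R p r :=
  ⟨h.trans p q r hp hq hr hpq hqr.1, fun hrp => hqr.2 (h.trans r p q hr hp hq hrp hpq)⟩

theorem mix_strict_mono (h : VNMAxioms R) (hp : IsLottery p) (hq : IsLottery q)
    (hpq : StrictPref R p q) {α β : ℝ} (hβ : 0 ≤ β) (hβα : β < α) (hα : α ≤ 1) :
    StrictPref R (mix α p q) (mix β p q) := by
  have hα0 : 0 < α := hβ.trans_lt hβα
  have hx : IsLottery (mix α p q) := hp.mix hq hα0.le hα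
  have h1 : StrictPref R (mix α p q) q := by
    simpa only [mix_self] using h.indep p q q hp hq hq α hα0 hα hpq
  have h2 := h.indep _ _ _ hx hq hx (1 - β / α)
    (by rw [sub_pos, div_lt_one hα0]; exact hβα)
    (by have := div_nonneg hβ hα0.le; linarith) h1
  rwa [mix_self, ← mix_comm, mix_mix_left, div_mul_cancel₀ _ hα0.ne'] at h2

theorem mix_weak_mono_iff (h : VNMAxioms R) (hp : IsLottery p) (hq : IsLottery q)
    (hpq : StrictPref R p q) {α β : ℝ} (hα : α ∈ Set.Icc (0 : ℝ) 1)
    (hβ : β ∈ Set.Icc (0 : ℝ) 1) : R (mix α p q) (mix β p q) ↔ β ≤ α := by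
  constructor
  · intro hR
    by_contra! hlt
    exact (h.mix_strict_mono hp hq hpq hα.1 hlt hβ.2).2 hR
  · intro hle
    rcases hle.eq_or_lt with rfl | hlt
    · exact h.refl (hp.mix hq hα.1 hα.2)
    · exact (h.mix_strict_mono hp hq hpq hβ.1 hlt hα.2).1

/-- A mixture of two lotteries is not strictly better than the better one. -/
theorem weak_mix_of_weak (h : VNMAxioms R) (hp : IsLottery p) (hq : IsLottery q)
    (hpq : R p q) {α : ℝ} (h0 : 0 ≤ α) (h1 : α ≤ 1) : R p (mix α p q) := by
  rcases h0.eq_or_lt with rfl | h0'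
  · rwa [mix_zero]
  rcases h1.eq_or_lt with rfl | h1'
  · rw [mix_one]; exact h.refl hp
  have hw := hp.mix hq h0 h1
  by_contra hn
  have hwp := h.strict_of_not hp hw hn
  have hwq := h.strict_trans_weak hw hp hq hwp hpq
  have e1 := h.indep _ _ _ hw hp hw α h0' h1 hwp
  have e2 := h.indep _ _ _ hw hq hp (1 - α) (by linarith) (by linarith) hwq
  rw [mix_self] at e1
  rw [← mix_comm, ← mix_comm] at e2
  exact e1.2 e2.1

theorem mix_congr_left_of_strict (h : VNMAxioms R) (hp : IsLottery p) (hq : IsLottery q)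
    (hr : IsLottery r) (hqp : R q p) (hpr : StrictPref R p r) {α : ℝ}
    (h0 : 0 < α) (h1 : α ≤ 1) : R (mix α q r) (mix α p r) := by
  have hqr := h.weak_trans_strict hq hp hr hqp hpr
  have hx := hp.mix hr h0.le h1
  have hy := hq.mix hr h0.le h1
  by_contra hn
  have hyr : StrictPref R (mix α q r) r := by
    simpa only [mix_self] using h.indep q r r hq hr hr α h0 h1 hqr
  obtain ⟨β, -, hβ0, hβ1, -, -, hβ, -⟩ :=
    h.cont _ _ _ hx hy hr (h.strict_of_not hy hx hn) hyr
  have hpβ : StrictPref R p (mix β p r) := by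
    simpa only [mix_one] using h.mix_strict_mono hp hr hpr hβ0.le hβ1 le_rfl
  have hm := hp.mix hr hβ0.le hβ1.le
  have hqβ := h.weak_trans_strict hq hp hm hqp hpβ
  have e := h.indep _ _ _ hq hm hr α h0 h1 hqβ
  rw [mix_mix_left, mul_comm, ← mix_mix_left] at e
  exact hβ.2 e.1

/-- Replacing a component of a mixture by an indifferent one preserves weak preference. -/
theorem mix_congr_left (h : VNMAxioms R) (hp : IsLottery p) (hq : IsLottery q)
    (hr : IsLottery r) (hpq : R p q) (hqp : R q p) {α : ℝ}
    (h0 : 0 ≤ α) (h1 : α ≤ 1) : R (mix α q r) (mix α p r) := by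
  rcases h0.eq_or_lt with rfl | h0'
  · rw [mix_zero, mix_zero]; exact h.refl hr
  by_cases hpr : R p r
  · by_cases hrp : R r p
    · have hrq := h.trans r p q hr hp hq hrp hpq
      have hx := hp.mix hr h0 h1
      have hy := hq.mix hr h0 h1
      have e1 : R (mix α q r) q := h.swap.weak_mix_of_weak hq hr hrq h0 h1
      have e2 : R p (mix α p r) := h.weak_mix_of_weak hp hr hpr h0 h1
      exact h.trans _ q _ hy hq hx e1 (h.trans q p _ hq hp hx hqp e2)
    · exact h.mix_congr_left_of_strict hp hq hr hqp ⟨hpr, hrp⟩ h0' h1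
  · have hrq := h.strict_trans_weak hr hp hq (h.strict_of_not hp hr hpr) hpq
    exact h.swap.mix_congr_left_of_strict hq hp hr hqp hrq h0' h1

theorem mix_congr (h : VNMAxioms R) {p p' q q' : Z → ℝ} (hp : IsLottery p)
    (hp' : IsLottery p') (hq : IsLottery q) (hq' : IsLottery q') (hpp' : R p p')
    (hp'p : R p' p) (hqq' : R q q') (hq'q : R q' q) {α : ℝ} (h0 : 0 ≤ α) (h1 : α ≤ 1) :
    R (mix α p q) (mix α p' q') := by
  refine h.trans _ (mix α p' q) _ (hp.mix hq h0 h1) (hp'.mix hq h0 h1) (hp'.mix hq' h0 h1)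
    (h.mix_congr_left hp' hp hq hp'p hpp' h0 h1) ?_
  rw [mix_comm α p' q, mix_comm α p' q']
  exact h.mix_congr_left hq' hq hp' hq'q hqq' (by linarith) (by linarith)

/-- Every lottery between `p` and `r` is indifferent to a mixture of `p` and `r`. -/
theorem exists_indiff_mix (h : VNMAxioms R) (hp : IsLottery p) (hq : IsLottery q)
    (hr : IsLottery r) (hpr : StrictPref R p r) (hpq : R p q) (hqr : R q r) :
    ∃ α ∈ Set.Icc (0 : ℝ) 1, R q (mix α p r) ∧ R (mix α p r) q := by
  by_cases hqp : R q p
  · exact ⟨1, by simp, by rwa [mix_one], by rwa [mix_one]⟩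
  by_cases hrq : R r q
  · exact ⟨0, by simp, by rwa [mix_zero], by rwa [mix_zero]⟩
  let A : Set ℝ := {α | α ∈ Set.Icc (0 : ℝ) 1 ∧ R q (mix α p r)}
  have hA0 : (0 : ℝ) ∈ A := ⟨by simp, by rwa [mix_zero]⟩
  have hAb : BddAbove A := ⟨1, fun x hx => hx.1.2⟩
  have hs0 : 0 ≤ sSup A := le_csSup hAb hA0
  have hs1 : sSup A ≤ 1 := csSup_le ⟨0, hA0⟩ fun x hx => hx.1.2
  have hm := hp.mix hr hs0 hs1
  refine ⟨sSup A, ⟨hs0, hs1⟩, ?_, ?_⟩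
  · by_contra hn
    obtain ⟨β, -, hβ0, hβ1, -, -, hβ, -⟩ :=
      h.cont _ _ _ hm hq hr (h.strict_of_not hq hm hn) ⟨hqr, hrq⟩
    rw [mix_mix_left] at hβ
    have hs : 0 < sSup A := by
      refine hs0.lt_of_ne fun e => hn ?_
      rwa [← e, mix_zero]
    obtain ⟨α, hα, hlt⟩ := exists_lt_of_lt_csSup ⟨0, hA0⟩
      (mul_lt_of_lt_one_left hs hβ1)
    have hβs : 0 ≤ β * sSup A := by positivity
    have e := h.mix_strict_mono hp hr hpr hβs hlt hα.1.2
    exact hβ.2 (h.trans _ _ _ hq (hp.mix hr hα.1.1 hα.1.2)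
      (hp.mix hr hβs (hlt.le.trans hα.1.2)) hα.2 e.1)
  · by_contra hn
    obtain ⟨-, β, -, -, hβ0, hβ1, -, hβ⟩ :=
      h.cont _ _ _ hp hq hm ⟨hpq, hqp⟩ (h.strict_of_not hm hq hn)
    have hs : sSup A < 1 := by
      refine hs1.lt_of_ne fun e => hn ?_
      rwa [e, mix_one]
    have e : mix β p (mix (sSup A) p r) = mix (β * 1 + (1 - β) * sSup A) p r := by
      rw [← mix_mix, mix_one]
    rw [e] at hβ
    have hmem : β * 1 + (1 - β) * sSup A ∈ A :=
      ⟨⟨by nlinarith, by nlinarith⟩, hβ.1⟩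
    have := le_csSup hAb hmem
    nlinarith

theorem indiff_mix_expUtil [DecidableEq Z] (h : VNMAxioms R) {b w : Z → ℝ}
    (hb : IsLottery b) (hw : IsLottery w) {u : Z → ℝ} (hu : ∀ z, u z ∈ Set.Icc (0 : ℝ) 1)
    (hz : ∀ z, R (Pi.single z 1) (mix (u z) b w) ∧ R (mix (u z) b w) (Pi.single z 1))
    (hp : IsLottery p) :
    R p (mix (expUtil u p) b w) ∧ R (mix (expUtil u p) b w) p := by
  let S : Set (Z → ℝ) := {p | IsLottery p ∧
    R p (mix (expUtil u p) b w) ∧ R (mix (expUtil u p) b w) p}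
  have hS : Convex ℝ S := by
    rintro x ⟨hx, hx1, hx2⟩ y ⟨hy, hy1, hy2⟩ s t hs ht hst
    obtain rfl : t = 1 - s := by linarith
    have e : s • x + (1 - s) • y = mix s x y := by funext z; simp [mix]
    have hs1 : s ≤ 1 := by linarith
    have hux := expUtil_mem_Icc hx hu
    have huy := expUtil_mem_Icc hy hu
    have hmx := hb.mix hw hux.1 hux.2
    have hmy := hb.mix hw huy.1 huy.2
    rw [e]
    refine ⟨hx.mix hy hs hs1, ?_, ?_⟩
    · rw [expUtil_mix, ← mix_mix]
      exact h.mix_congr hx hmx hy hmy hx1 hx2 hy1 hy2 hs hs1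
    · rw [expUtil_mix, ← mix_mix]
      exact h.mix_congr hmx hx hmy hy hx2 hx1 hy2 hy1 hs hs1
  have hsub : Set.range (fun z : Z => (Pi.single z (1 : ℝ) : Z → ℝ)) ⊆ S := by
    rintro _ ⟨z, rfl⟩
    refine ⟨isLottery_single z, ?_⟩
    rw [expUtil_single]
    exact hz z
  have hp' : p ∈ stdSimplex ℝ Z := hp
  rw [← convexHull_rangle_single_eq_stdSimplex] at hp'
  exact (convexHull_min hsub hS hp').2

theorem exists_best [Nonempty Z] [DecidableEq Z] (h : VNMAxioms R) :
    ∃ b : Z, ∀ z : Z, R (Pi.single b 1) (Pi.single z 1) := by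
  have : IsTrans Z (fun x y => R (Pi.single y 1) (Pi.single x 1)) :=
    ⟨fun x y z hxy hyz => h.trans _ _ _ (isLottery_single z) (isLottery_single y)
      (isLottery_single x) hyz hxy⟩
  have hd : Directed (fun x y : Z => R (Pi.single y 1) (Pi.single x 1)) id := by
    intro x y
    rcases h.complete _ _ (isLottery_single x) (isLottery_single y) with hxy | hyx
    · exact ⟨x, h.refl (isLottery_single x), hxy⟩
    · exact ⟨y, hyx, h.refl (isLottery_single y)⟩
  exact hd.finite_le id

theorem exists_represents [Nonempty Z] (h : VNMAxioms R) : ∃ u : Z → ℝ, Represents R u := by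
  classical
  obtain ⟨b, hb⟩ := h.exists_best
  obtain ⟨w, hw⟩ := h.swap.exists_best
  have lb := isLottery_single b
  have lw := isLottery_single w
  by_cases hwb : R (Pi.single w 1) (Pi.single b 1)
  · have key : ∀ p, IsLottery p → R p (Pi.single w 1) ∧ R (Pi.single w 1) p := by
      intro p hp
      have := h.indiff_mix_expUtil lb lw (u := fun _ => 0) (by simp)
        (fun z => by
          rw [mix_zero]
          exact ⟨hw z, h.trans _ _ _ lw lb (isLottery_single z) hwb (hb z)⟩) hp
      simpa [expUtil, mix_zero] using this
    refine ⟨fun _ => 0, fun p q hp hq => ?_⟩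
    have := h.trans _ _ _ hp lw hq (key p hp).1 (key q hq).2
    simpa [expUtil] using this
  · have hbw : StrictPref R (Pi.single b 1) (Pi.single w 1) := ⟨hb w, hwb⟩
    choose u hu hz using fun z =>
      h.exists_indiff_mix lb (isLottery_single z) lw hbw (hb z) (hw z)
    refine ⟨u, fun p q hp hq => ?_⟩
    have hup := expUtil_mem_Icc hp hu
    have huq := expUtil_mem_Icc hq hu
    have hmp := lb.mix lw hup.1 hup.2
    have hmq := lb.mix lw huq.1 huq.2
    obtain ⟨p1, p2⟩ := h.indiff_mix_expUtil lb lw hu hz hp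
    obtain ⟨q1, q2⟩ := h.indiff_mix_expUtil lb lw hu hz hq
    rw [ge_iff_le, ← h.mix_weak_mono_iff lb lw hbw hup huq]
    exact ⟨fun hpq => h.trans _ _ _ hmp hp hmq p2 (h.trans _ _ _ hp hq hmq hpq q1),
      fun hm => h.trans _ _ _ hp hmp hq p1 (h.trans _ _ _ hmp hmq hq hm q2)⟩

end VNMAxioms

namespace Represents

variable {Z : Type*} [Fintype Z] {R : (Z → ℝ) → (Z → ℝ) → Prop} {u u' : Z → ℝ}

theorem strictPref_iff (h : Represents R u) {p q : Z → ℝ} (hp : IsLottery p)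
    (hq : IsLottery q) : StrictPref R p q ↔ expUtil u q < expUtil u p := by
  rw [StrictPref, h p q hp hq, h q p hq hp, ge_iff_le, ge_iff_le, not_le]
  exact ⟨fun H => H.2, fun H => ⟨H.le, H⟩⟩

theorem vnmAxioms (h : Represents R u) : VNMAxioms R where
  complete p q hp hq := by
    rw [h p q hp hq, h q p hq hp]
    exact le_total _ _
  trans p q r hp hq hr := by
    rw [h p q hp hq, h q r hq hr, h p r hp hr]
    exact ge_trans
  indep p q r hp hq hr α h0 h1 := by
    rw [h.strictPref_iff hp hq, h.strictPref_iff (hp.mix hr h0.le h1) (hq.mix hr h0.le h1),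
      expUtil_mix, expUtil_mix]
    intro hlt
    have := mul_lt_mul_of_pos_left hlt h0
    linarith
  cont p q r hp hq hr := by
    rw [h.strictPref_iff hp hq, h.strictPref_iff hq hr]
    intro hpq hqr
    set x := expUtil u p with hx
    set y := expUtil u q with hy
    set z := expUtil u r with hz
    have hd : 0 < 2 * (x - z) := by linarith
    have a0 : 0 < (x + y - 2 * z) / (2 * (x - z)) := div_pos (by linarith) hd
    have a1 : (x + y - 2 * z) / (2 * (x - z)) < 1 := (div_lt_one hd).2 (by linarith)
    have b0 : 0 < (y - z) / (2 * (x - z)) := div_pos (by linarith) hd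
    have b1 : (y - z) / (2 * (x - z)) < 1 := (div_lt_one hd).2 (by linarith)
    refine ⟨_, _, a0, a1, b0, b1, ?_, ?_⟩
    · rw [h.strictPref_iff (hp.mix hr a0.le a1.le) hq, expUtil_mix, ← hx, ← hy, ← hz]
      have := div_mul_cancel₀ (x + y - 2 * z) hd.ne'
      linarith
    · rw [h.strictPref_iff hq (hp.mix hr b0.le b1.le), expUtil_mix, ← hx, ← hy, ← hz]
      have := div_mul_cancel₀ (y - z) hd.ne'
      linarith

theorem expUtil_le_iff (h : Represents R u) (h' : Represents R u') {p q : Z → ℝ}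
    (hp : IsLottery p) (hq : IsLottery q) :
    expUtil u q ≤ expUtil u p ↔ expUtil u' q ≤ expUtil u' p :=
  (h p q hp hq).symm.trans (h' p q hp hq)

/-- A representing utility is unique up to a positive affine transformation. -/
theorem exists_affine [Nonempty Z] (h : Represents R u) (h' : Represents R u') :
    ∃ a b : ℝ, 0 < a ∧ ∀ z, u' z = a * u z + b := by
  classical
  obtain ⟨m, hm⟩ := Finite.exists_max u
  obtain ⟨n, hn⟩ := Finite.exists_min u
  have hle : ∀ x y, u x ≤ u y ↔ u' x ≤ u' y := fun x y => by
    simpa only [expUtil_single] using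
      h.expUtil_le_iff h' (isLottery_single y) (isLottery_single x)
  rcases (hm n).eq_or_lt with heq | hlt
  · refine ⟨1, u' n - u n, one_pos, fun z => ?_⟩
    have h1 : u z = u n := le_antisymm (heq ▸ hm z) (hn z)
    have h2 : u' z = u' n := le_antisymm ((hle _ _).1 h1.le) ((hle _ _).1 h1.ge)
    rw [h1, h2]; ring
  · have hd : 0 < u m - u n := sub_pos.2 hlt
    have hd' : 0 < u' m - u' n := sub_pos.2 (lt_of_not_ge fun H => hlt.not_ge ((hle _ _).2 H))
    refine ⟨(u' m - u' n) / (u m - u n), u' n - (u' m - u' n) / (u m - u n) * u n,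
      div_pos hd' hd, fun z => ?_⟩
    set t := (u z - u n) / (u m - u n) with ht
    have t0 : 0 ≤ t := div_nonneg (sub_nonneg.2 (hn z)) hd.le
    have t1 : t ≤ 1 := (div_le_one hd).2 (by linarith [hm z])
    have hmix := (isLottery_single m).mix (isLottery_single n) t0 t1
    have hut : t * (u m - u n) = u z - u n := div_mul_cancel₀ _ hd.ne'
    have e1 := h.expUtil_le_iff h' hmix (isLottery_single z)
    have e2 := h.expUtil_le_iff h' (isLottery_single z) hmix
    simp only [expUtil_mix, expUtil_single] at e1 e2
    have e : u' z = t * u' m + (1 - t) * u' n :=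
      le_antisymm (e1.1 (by linarith)) (e2.1 (by linarith))
    rw [e, ht]
    field_simp
    ring

end Represents

/-- vNM theorem: the four axioms hold iff the relation admits an expected-utility
representation; moreover the representing utility is unique up to a positive affine
transformation. -/
theorem vnm_counterfactual_utility (Z : Type*) [Fintype Z] [Nonempty Z]
    (R : (Z → ℝ) → (Z → ℝ) → Prop) :
    ((CompleteAx R ∧ TransitiveAx R ∧ IndependenceAx R ∧ ContinuityAx R) ↔
      ∃ u : Z → ℝ, Represents R u) ∧
    (∀ u u' : Z → ℝ, Represents R u → Represents R u' →
      ∃ a b : ℝ, 0 < a ∧ ∀ z, u' z = a * u z + b) := by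
  exact ⟨⟨fun ⟨h1, h2, h3, h4⟩ => (VNMAxioms.mk h1 h2 h3 h4).exists_represents,
    fun ⟨_, hu⟩ => ⟨hu.vnmAxioms.complete, hu.vnmAxioms.trans, hu.vnmAxioms.indep,
      hu.vnmAxioms.cont⟩⟩, fun _ _ hu hu' => hu.exists_affine hu'⟩
end

section
/- Let Y be a finite nonempty type and let ψ : Y × Y → ℝ (interpreting ψ(y, y') as the counterfactual utility of a chosen option yielding y when the unchosen option yields y'; this encodes a label-neutral counterfactual utility ũ with ũ(0; y₀, y₁) = ψ(y₀, y₁) = ũ(1; y₁, y₀)). The following are equivalent: (1) for every lottery P on Y × Y × Y, the binary relation on the index set {0, 1, 2} defined by i ≿ j iff E_P[ψ(Y_i, Y_j)] ≥ E_P[ψ(Y_j, Y_i)] (where Y_i denotes the i-th coordinate) is transitive; (2) there exist u : Y → ℝ and a symmetric function h : Y × Y → ℝ (i.e., h(y, y') = h(y', y) for all y, y') such that ψ(y, y') = u(y) + h(y, y') for all y, y' ∈ Y. -/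
/-- The `i`-th coordinate of a triple. -/
def coord3 {Y : Type*} (i : Fin 3) (t : Y × Y × Y) : Y :=
  if i = 0 then t.1 else if i = 1 then t.2.1 else t.2.2

open scoped Classical in
/-- The uniform mixture of the three cyclic permutations of `(a, b, c)`. -/
noncomputable def cyclicLottery {Y : Type*} (a b c : Y) (t : Y × Y × Y) : ℝ :=
  ((if t = (a, b, c) then 1 else 0) + (if t = (b, c, a) then 1 else 0) +
    (if t = (c, a, b) then 1 else 0)) / 3

theorem sum_mul_cyclicLottery {Y : Type*} [Fintype Y] (a b c : Y) (f : Y × Y × Y → ℝ) :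
    ∑ t, f t * cyclicLottery a b c t = (f (a, b, c) + f (b, c, a) + f (c, a, b)) / 3 := by
  classical
  simp only [cyclicLottery, mul_div_assoc', mul_add, ← Finset.sum_div, Finset.sum_add_distrib,
    mul_ite, mul_one, mul_zero, Finset.sum_ite_eq', Finset.mem_univ, if_true]

theorem isLottery_cyclicLottery {Y : Type*} [Fintype Y] (a b c : Y) :
    IsLottery (cyclicLottery a b c) := by
  refine ⟨fun t => ?_, ?_⟩
  · unfold cyclicLottery
    positivity
  · have h := sum_mul_cyclicLottery a b c (fun _ => 1)
    norm_num at h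
    exact h

/-- A real-valued `ψ` is a function of its first argument plus a symmetric function as soon as its
cyclic sums are dominated by the reversed ones. -/
theorem exists_add_symmetric_of_cyclic_sum_le {Y : Type*} [Nonempty Y] (ψ : Y × Y → ℝ)
    (H : ∀ a b c, ψ (a, b) + ψ (b, c) + ψ (c, a) ≤ ψ (b, a) + ψ (c, b) + ψ (a, c)) :
    ∃ (u : Y → ℝ) (h : Y × Y → ℝ), (∀ y y' : Y, h (y, y') = h (y', y)) ∧
      ∀ y y' : Y, ψ (y, y') = u y + h (y, y') := by
  obtain ⟨o⟩ := ‹Nonempty Y›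
  refine ⟨fun y => ψ (y, o) - ψ (o, y), fun p => ψ p - (ψ (p.1, o) - ψ (o, p.1)),
    fun y y' => ?_, fun y y' => by ring⟩
  linarith [H y y' o, H y' y o]

/-- (Lanzani) The pairwise relation `i ≿ j ↔ E_P[ψ(Y_i, Y_j)] ≥ E_P[ψ(Y_j, Y_i)]` is
transitive for every lottery `P` on `Y × Y × Y` iff `ψ` decomposes as
`ψ(y, y') = u(y) + h(y, y')` with `h` symmetric. -/
theorem menu_projection_transitivity_characterization
    (Y : Type*) [Fintype Y] [Nonempty Y] (ψ : Y × Y → ℝ) :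
    (∀ P : Y × Y × Y → ℝ, IsLottery P →
      ∀ i j k : Fin 3,
        (∑ t, ψ (coord3 i t, coord3 j t) * P t ≥ ∑ t, ψ (coord3 j t, coord3 i t) * P t) →
        (∑ t, ψ (coord3 j t, coord3 k t) * P t ≥ ∑ t, ψ (coord3 k t, coord3 j t) * P t) →
        (∑ t, ψ (coord3 i t, coord3 k t) * P t ≥ ∑ t, ψ (coord3 k t, coord3 i t) * P t))
    ↔
    (∃ (u : Y → ℝ) (h : Y × Y → ℝ), (∀ y y' : Y, h (y, y') = h (y', y)) ∧
      ∀ y y' : Y, ψ (y, y') = u y + h (y, y')) := by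
  constructor
  · refine fun H => exists_add_symmetric_of_cyclic_sum_le ψ fun a b c => ?_
    by_contra! hlt
    have h := H _ (isLottery_cyclicLottery a b c) 0 1 2
    simp only [sum_mul_cyclicLottery _ _ _ (fun t => ψ (coord3 _ t, coord3 _ t))] at h
    simp only [coord3, Fin.isValue, if_true, one_ne_zero, if_false, Fin.reduceEq] at h
    linarith [h (by linarith) (by linarith)]
  · rintro ⟨u, h, hsymm, hψ⟩ P - i j k hij hjk
    have key (m n : Fin 3) : ∑ t, ψ (coord3 m t, coord3 n t) * P t -
        ∑ t, ψ (coord3 n t, coord3 m t) * P t =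
        ∑ t, u (coord3 m t) * P t - ∑ t, u (coord3 n t) * P t := by
      rw [← Finset.sum_sub_distrib, ← Finset.sum_sub_distrib]
      refine Finset.sum_congr rfl fun t _ => ?_
      rw [hψ, hψ, hsymm (coord3 n t)]
      ring
    linarith [key i j, key j k, key i k]
end

section
/- Let D and Y be finite nonempty types and let ũ : (D → Y) → ℝ. Suppose that for all lotteries P, Q on the function type D → Y satisfying, for every k ∈ D and every v ∈ Y, P{ f : f k = v } = Q{ f : f k = v } (i.e., P and Q have identical marginals in every coordinate), one has E_P[ũ] = E_Q[ũ]. Then there exist functions u_k : Y → ℝ for k ∈ D such that ũ(f) = ∑ k ∈ D, u_k(f k) for all f : D → Y. -/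
/-- The average of the point masses at the points `φ i` of a finite family is a lottery. -/
noncomputable def empiricalLottery {ι Z : Type*} [Fintype ι] [DecidableEq Z] (φ : ι → Z) (z : Z) :
    ℝ :=
  (∑ i, if z = φ i then 1 else 0) / Fintype.card ι

theorem sum_mul_empiricalLottery {ι Z : Type*} [Fintype ι] [Fintype Z] [DecidableEq Z]
    (φ : ι → Z) (g : Z → ℝ) :
    ∑ z, g z * empiricalLottery φ z = (∑ i, g (φ i)) / Fintype.card ι := by
  simp only [empiricalLottery, mul_div_assoc', Finset.mul_sum, ← Finset.sum_div]
  rw [Finset.sum_comm]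
  simp

theorem isLottery_empiricalLottery {ι Z : Type*} [Fintype ι] [Nonempty ι] [Fintype Z]
    [DecidableEq Z] (φ : ι → Z) : IsLottery (empiricalLottery φ) := by
  refine ⟨fun z => ?_, ?_⟩
  · unfold empiricalLottery
    positivity
  · simpa using sum_mul_empiricalLottery φ fun _ => 1

/-- Summing over `j` a function of the `k`-th coordinate gives the same result for the family
`Function.update a j (f j)` as for the family equal to `f` at `i` and to `a` elsewhere. -/
theorem sum_apply_update_eq {D Y : Type*} [Fintype D] [DecidableEq D] (a f : D → Y) (i k : D)
    (g : Y → ℝ) :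
    ∑ j, g ((if j = i then f else a) k) = ∑ j, g (Function.update a j (f j) k) := by
  have h₁ (j : D) : g ((if j = i then f else a) k) =
      (if j = i then g (f k) - g (a k) else 0) + g (a k) := by
    split_ifs <;> simp
  have h₂ (j : D) : g (Function.update a j (f j) k) =
      (if j = k then g (f k) - g (a k) else 0) + g (a k) := by
    by_cases hj : j = k
    · subst hj
      simp
    · simp [hj, Function.update_of_ne (Ne.symm hj)]
  simp [h₁, h₂, Finset.sum_add_distrib]

/-- (Fishburn additivity lemma) If the expectation of `util` agrees on any two lotteries on
`D → Y` that have identical marginals in every coordinate, then `util` is additively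
separable: `util f = ∑ k, u k (f k)`. -/
theorem additive_of_marginal_invariance
    (D Y : Type*) [Fintype D] [DecidableEq D] [Nonempty D]
    [Fintype Y] [DecidableEq Y] [Nonempty Y]
    (util : (D → Y) → ℝ)
    (h : ∀ P Q : (D → Y) → ℝ, IsLottery P → IsLottery Q →
      (∀ (k : D) (v : Y),
        (∑ f, if f k = v then P f else 0) = (∑ f, if f k = v then Q f else 0)) →
      (∑ f, util f * P f) = (∑ f, util f * Q f)) :
    ∃ u : D → Y → ℝ, ∀ f : D → Y, util f = ∑ k, u k (f k) := by
  let i : D := Classical.arbitrary D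
  let a : D → Y := fun _ => Classical.arbitrary Y
  have hn : (Fintype.card D : ℝ) ≠ 0 := by simp
  refine ⟨fun k y => util (Function.update a k y) -
    (Fintype.card D - 1) / Fintype.card D * util a, fun f => ?_⟩
  have key := h (empiricalLottery fun j => if j = i then f else a)
    (empiricalLottery fun j => Function.update a j (f j))
    (isLottery_empiricalLottery _) (isLottery_empiricalLottery _) fun k v => by
      have marginal (φ : D → D → Y) := sum_mul_empiricalLottery φ fun x => if x k = v then 1 else 0
      simp only [ite_mul, one_mul, zero_mul] at marginal
      rw [marginal, marginal, sum_apply_update_eq a f i k fun y => if y = v then 1 else 0]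
  rw [sum_mul_empiricalLottery, sum_mul_empiricalLottery, div_left_inj' hn] at key
  have hsum : ∑ j, util (if j = i then f else a) =
      util f + (Fintype.card D - 1) * util a := by
    have hj (j : D) : util (if j = i then f else a) =
        (if j = i then util f - util a else 0) + util a := by
      split_ifs <;> simp
    simp only [hj, Finset.sum_add_distrib, Finset.sum_ite_eq', Finset.mem_univ, if_true,
      Finset.sum_const, Finset.card_univ, nsmul_eq_mul]
    ring
  rw [Finset.sum_sub_distrib, ← key, hsum, Finset.sum_const, Finset.card_univ, nsmul_eq_mul]
  field_simp
  ring
end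

section
/- Let L < U be real numbers and I := [L, U] ⊆ ℝ, and let Γ : ℝ × ℝ → ℝ satisfy on I × I: (i) for each fixed p₀ ∈ I the map p₁ ↦ Γ(p₀, p₁) is non-decreasing on I, and for each fixed p₁ ∈ I the map p₀ ↦ Γ(p₀, p₁) is non-increasing on I; (ii) for each fixed p₀ ∈ I, the map p₁ ↦ Γ(p₀, p₁) has at most one root in I; (iii) for each fixed p₀ ∈ I, if there exist a < b in I with Γ(p₀, a) < 0 and Γ(p₀, b) > 0, then there exists τ ∈ (a, b) with Γ(p₀, τ) = 0. Then there exists a non-decreasing function φ₀ : I → ℝ (with values in [L − 1, U + 1]) such that for all (p₀, p₁) ∈ I × I: Γ(p₀, p₁) > 0 ↔ p₁ − φ₀(p₀) > 0, and Γ(p₀, p₁) = 0 ↔ p₁ − φ₀(p₀) = 0. Consequently, taking φ₁ to be the identity, the extended standard utility u^Ext(d; p_d) := φ_d(p_d) induces exactly the same decision recommendation as Γ in every state (p₀, p₁) ∈ I × I. -/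
/-- A monotone function on `[L, U]` with at most one root and the crossing property has the sign
of `x - t` for some threshold `t`, which lies in `[L, U]` or is one of `L - 1`, `U + 1`. -/
theorem exists_sign_threshold {L U : ℝ} (hLU : L ≤ U) {g : ℝ → ℝ}
    (hmono : MonotoneOn g (Set.Icc L U))
    (huniq : ∀ a ∈ Set.Icc L U, ∀ b ∈ Set.Icc L U, g a = 0 → g b = 0 → a = b)
    (hcross : g L < 0 → 0 < g U → ∃ r ∈ Set.Icc L U, g r = 0) :
    ∃ t : ℝ, (t ∈ Set.Icc L U ∨ t = L - 1 ∨ t = U + 1) ∧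
      ∀ x ∈ Set.Icc L U, (0 < g x ↔ t < x) ∧ (g x = 0 ↔ x = t) := by
  have hL : L ∈ Set.Icc L U := ⟨le_rfl, hLU⟩
  have hU : U ∈ Set.Icc L U := ⟨hLU, le_rfl⟩
  by_cases hroot : ∃ r ∈ Set.Icc L U, g r = 0
  · obtain ⟨r, hr, hr0⟩ := hroot
    refine ⟨r, Or.inl hr, fun x hx => ⟨⟨fun h => ?_, fun h => ?_⟩, fun h => ?_, fun h => ?_⟩⟩
    · by_contra! hxr
      have := hmono hx hr hxr
      linarith
    · have hge := hmono hr hx h.le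
      rw [hr0] at hge
      exact hge.lt_of_ne fun h0 => h.ne (huniq r hr x hx hr0 h0.symm)
    · exact huniq x hx r hr h hr0
    · rw [h, hr0]
  · have hne : ∀ x ∈ Set.Icc L U, g x ≠ 0 := fun x hx h => hroot ⟨x, hx, h⟩
    rcases (hne L hL).lt_or_gt with hneg | hpos
    · have hUneg : g U < 0 :=
        (hne U hU).lt_or_gt.resolve_right fun h => hroot (hcross hneg h)
      refine ⟨U + 1, Or.inr (Or.inr rfl), fun x hx => ?_⟩
      have hgx := hmono hx hU hx.2
      have hxU := hx.2
      constructor <;> constructor <;> intro h <;> linarith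
    · refine ⟨L - 1, Or.inr (Or.inl rfl), fun x hx => ?_⟩
      have hgx := hmono hL hx hx.1
      have hxL := hx.1
      constructor <;> constructor <;> intro h <;> linarith


/-- (Lemma on reduction to an extended standard utility) Given a contrast `Γ` on
`I × I = [L,U] × [L,U]` that is non-decreasing in `p₁`, non-increasing in `p₀`, has at
most one root in `p₁` for each fixed `p₀`, and satisfies an intermediate-value crossing
property, there is a non-decreasing `φ₀ : I → [L-1, U+1]` such that (taking `φ₁ = id`) the
extended standard utility contrast `p₁ - φ₀(p₀)` has the same sign as `Γ(p₀, p₁)` on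
`I × I`, hence induces exactly the same decision recommendation in every state. -/
theorem extended_standard_utility_reduction (L U : ℝ) (hLU : L < U) (Γ : ℝ → ℝ → ℝ)
    (hmono1 : ∀ p₀ ∈ Set.Icc L U, ∀ p₁ ∈ Set.Icc L U, ∀ p₁' ∈ Set.Icc L U,
      p₁ ≤ p₁' → Γ p₀ p₁ ≤ Γ p₀ p₁')
    (hmono0 : ∀ p₁ ∈ Set.Icc L U, ∀ p₀ ∈ Set.Icc L U, ∀ p₀' ∈ Set.Icc L U,
      p₀ ≤ p₀' → Γ p₀' p₁ ≤ Γ p₀ p₁)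
    (huniq : ∀ p₀ ∈ Set.Icc L U, ∀ a ∈ Set.Icc L U, ∀ b ∈ Set.Icc L U,
      Γ p₀ a = 0 → Γ p₀ b = 0 → a = b)
    (hcross : ∀ p₀ ∈ Set.Icc L U, ∀ a ∈ Set.Icc L U, ∀ b ∈ Set.Icc L U,
      a < b → Γ p₀ a < 0 → 0 < Γ p₀ b →
        ∃ τ : ℝ, a < τ ∧ τ < b ∧ Γ p₀ τ = 0) :
    ∃ φ₀ : ℝ → ℝ,
      (∀ p ∈ Set.Icc L U, φ₀ p ∈ Set.Icc (L - 1) (U + 1)) ∧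
      (∀ p ∈ Set.Icc L U, ∀ p' ∈ Set.Icc L U, p ≤ p' → φ₀ p ≤ φ₀ p') ∧
      (∀ p₀ ∈ Set.Icc L U, ∀ p₁ ∈ Set.Icc L U,
        (0 < Γ p₀ p₁ ↔ 0 < p₁ - φ₀ p₀) ∧ (Γ p₀ p₁ = 0 ↔ p₁ - φ₀ p₀ = 0)) := by
  have hL : L ∈ Set.Icc L U := ⟨le_rfl, hLU.le⟩
  have hU : U ∈ Set.Icc L U := ⟨hLU.le, le_rfl⟩
  have hthreshold : ∀ p : ℝ, ∃ t : ℝ, p ∈ Set.Icc L U →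
      (t ∈ Set.Icc L U ∨ t = L - 1 ∨ t = U + 1) ∧
        ∀ x ∈ Set.Icc L U, (0 < Γ p x ↔ t < x) ∧ (Γ p x = 0 ↔ x = t) := by
    intro p
    by_cases hp : p ∈ Set.Icc L U
    · obtain ⟨t, ht⟩ := exists_sign_threshold hLU.le
        (fun a ha b hb hab => hmono1 p hp a ha b hb hab) (huniq p hp) (fun hneg hpos => by
          obtain ⟨r, hLr, hrU, hr⟩ := hcross p hp L hL U hU hLU hneg hpos
          exact ⟨r, ⟨hLr.le, hrU.le⟩, hr⟩)
      exact ⟨t, fun _ => ht⟩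
    · exact ⟨0, fun h => absurd h hp⟩
  choose φ hφ using hthreshold
  refine ⟨φ, fun p hp => ?_, fun p hp p' hp' hpp' => ?_, fun p hp x hx => ?_⟩
  · rcases (hφ p hp).1 with h | h | h
    · exact ⟨by linarith [h.1], by linarith [h.2]⟩
    · rw [h]; constructor <;> linarith
    · rw [h]; constructor <;> linarith
  · obtain ⟨hmem, hsign⟩ := hφ p hp
    obtain ⟨hmem', hsign'⟩ := hφ p' hp'
    by_contra! hlt
    have hempty : ∀ x ∈ Set.Icc L U, φ p' ≤ x → x ≤ φ p → False := by
      intro x hx hx' hxp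
      have hle := hmono0 x hx p hp p' hp' hpp'
      have hnonneg : 0 ≤ Γ p' x := by
        rcases hx'.lt_or_eq with h | h
        · exact ((hsign' x hx).1.2 h).le
        · exact ((hsign' x hx).2.2 h.symm).ge
      have hnonpos : Γ p x ≤ 0 := not_lt.1 fun h => hxp.not_gt ((hsign x hx).1.1 h)
      have h1 := (hsign x hx).2.1 (by linarith)
      have h2 := (hsign' x hx).2.1 (by linarith)
      linarith
    rcases hmem with h | h | h
    · exact hempty _ h hlt.le le_rfl
    · rcases hmem' with h' | h' | h'
      · exact hempty _ h' le_rfl hlt.le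
      all_goals linarith
    · rcases hmem' with h' | h' | h'
      · exact hempty _ h' le_rfl hlt.le
      · exact hempty L hL (by linarith) (by linarith)
      · linarith
  · rw [sub_pos, sub_eq_zero]
    exact (hφ p hp).2 x hx
end

section
/- Let Y := {1, 2, 3, 4, 5, 6} and let P be any lottery on Y × Y × Y whose three coordinate marginals are: the first coordinate Y_a equals 1 with probability 1/6 and 4 with probability 5/6; the second coordinate Y_b equals 2 with probability 1/2 and 5 with probability 1/2; the third coordinate Y_c equals 3 with probability 5/6 and 6 with probability 1/6. Then, for every such P (i.e., for every coupling of these marginals): P(Y_b > Y_a) ≥ P(Y_a > Y_b), P(Y_a > Y_c) > P(Y_c > Y_a), and P(Y_c > Y_b) ≥ P(Y_b > Y_c). -/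
/-- The outcome space `{1, 2, 3, 4, 5, 6}`. -/
abbrev Y6 := {n : ℕ // n ∈ Finset.Icc 1 6}

/-- If two disjoint events together carry all the mass of a lottery, every point of its support
lies in one of them. -/
theorem IsLottery.mem_of_ne_zero {Z : Type*} [Fintype Z] {p : Z → ℝ} (hp : IsLottery p)
    {A B : Z → Prop} [DecidablePred A] [DecidablePred B] {α β : ℝ}
    (hA : (∑ z, if A z then p z else 0) = α) (hB : (∑ z, if B z then p z else 0) = β)
    (hαβ : α + β = 1) (hAB : ∀ z, A z → ¬ B z) {z : Z} (hz : p z ≠ 0) : A z ∨ B z := by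
  have hsum : ∑ z, (if A z ∨ B z then 0 else p z) = 0 := by
    have hsplit : ∑ z, p z = (∑ z, if A z then p z else 0) + (∑ z, if B z then p z else 0) +
        ∑ z, (if A z ∨ B z then 0 else p z) := by
      rw [← Finset.sum_add_distrib, ← Finset.sum_add_distrib]
      refine Finset.sum_congr rfl fun z _ => ?_
      have := hAB z
      by_cases hA : A z <;> by_cases hB : B z <;> simp_all
    linarith [hp.2]
  rw [Finset.sum_eq_zero_iff_of_nonneg
    (fun z _ => by split_ifs <;> simp [hp.1 z])] at hsum
  by_contra hcon
  exact hz (by simpa [hcon] using hsum z (Finset.mem_univ z))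

/-- Monotonicity of lottery probabilities, tested on the support only. -/
theorem IsLottery.sum_ite_le {Z : Type*} [Fintype Z] {p : Z → ℝ} (hp : IsLottery p)
    {A B : Z → Prop} [DecidablePred A] [DecidablePred B]
    (h : ∀ z, p z ≠ 0 → A z → B z) :
    (∑ z, if A z then p z else 0) ≤ ∑ z, if B z then p z else 0 := by
  refine Finset.sum_le_sum fun z _ => ?_
  have h0 := hp.1 z
  by_cases hz : p z = 0
  · simp [hz]
  · have := h z hz
    split_ifs <;> simp_all

/-- For every coupling `P` on `Y × Y × Y` with the given marginals for the three
coordinates `Y_a` (1 w.p. 1/6, 4 w.p. 5/6), `Y_b` (2 w.p. 1/2, 5 w.p. 1/2), and `Y_c`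
(3 w.p. 5/6, 6 w.p. 1/6), we have `P(Y_b > Y_a) ≥ P(Y_a > Y_b)`,
`P(Y_a > Y_c) > P(Y_c > Y_a)`, and `P(Y_c > Y_b) ≥ P(Y_b > Y_c)`. -/
theorem sawant_stensrud_inequalities
    (P : Y6 × Y6 × Y6 → ℝ) (hP : IsLottery P)
    (ha1 : (∑ t, if (t.1 : ℕ) = 1 then P t else 0) = 1/6)
    (ha4 : (∑ t, if (t.1 : ℕ) = 4 then P t else 0) = 5/6)
    (hb2 : (∑ t, if (t.2.1 : ℕ) = 2 then P t else 0) = 1/2)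
    (hb5 : (∑ t, if (t.2.1 : ℕ) = 5 then P t else 0) = 1/2)
    (hc3 : (∑ t, if (t.2.2 : ℕ) = 3 then P t else 0) = 5/6)
    (hc6 : (∑ t, if (t.2.2 : ℕ) = 6 then P t else 0) = 1/6) :
    (∑ t, if (t.1 : ℕ) < (t.2.1 : ℕ) then P t else 0) ≥
      (∑ t, if (t.2.1 : ℕ) < (t.1 : ℕ) then P t else 0) ∧
    (∑ t, if (t.2.2 : ℕ) < (t.1 : ℕ) then P t else 0) >
      (∑ t, if (t.1 : ℕ) < (t.2.2 : ℕ) then P t else 0) ∧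
    (∑ t, if (t.2.1 : ℕ) < (t.2.2 : ℕ) then P t else 0) ≥
      (∑ t, if (t.2.2 : ℕ) < (t.2.1 : ℕ) then P t else 0) := by
  have hs : ∀ t, P t ≠ 0 → ((t.1 : ℕ) = 1 ∨ (t.1 : ℕ) = 4) ∧
      ((t.2.1 : ℕ) = 2 ∨ (t.2.1 : ℕ) = 5) ∧ ((t.2.2 : ℕ) = 3 ∨ (t.2.2 : ℕ) = 6) := fun t ht =>
    ⟨hP.mem_of_ne_zero ha1 ha4 (by norm_num) (fun _ _ => by omega) ht,
      hP.mem_of_ne_zero hb2 hb5 (by norm_num) (fun _ _ => by omega) ht,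
      hP.mem_of_ne_zero hc3 hc6 (by norm_num) (fun _ _ => by omega) ht⟩
  refine ⟨?_, ?_, ?_⟩
  · calc _ ≤ ∑ t, (if (t.2.1 : ℕ) = 2 then P t else 0) :=
          hP.sum_ite_le fun t ht h => by have := hs t ht; omega
      _ = ∑ t, (if (t.2.1 : ℕ) = 5 then P t else 0) := by rw [hb2, hb5]
      _ ≤ _ := hP.sum_ite_le fun t ht h => by have := hs t ht; omega
  · have hlt : (∑ t, if (t.1 : ℕ) < (t.2.2 : ℕ) then P t else 0) ≤
        (∑ t, if (t.1 : ℕ) = 1 then P t else 0) + ∑ t, if (t.2.2 : ℕ) = 6 then P t else 0 := by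
      rw [← Finset.sum_add_distrib]
      refine Finset.sum_le_sum fun t _ => ?_
      have h0 := hP.1 t
      by_cases ht : P t = 0
      · simp [ht]
      · have := hs t ht
        split_ifs <;> first | linarith | omega
    have htot : (∑ t, if (t.2.2 : ℕ) < (t.1 : ℕ) then P t else 0) +
        (∑ t, if (t.1 : ℕ) < (t.2.2 : ℕ) then P t else 0) = 1 := by
      rw [← hP.2, ← Finset.sum_add_distrib]
      refine Finset.sum_congr rfl fun t _ => ?_
      by_cases ht : P t = 0
      · simp [ht]
      · have := hs t ht
        split_ifs <;> first | linarith | omega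
    linarith
  · calc _ ≤ ∑ t, (if (t.2.1 : ℕ) = 5 then P t else 0) :=
          hP.sum_ite_le fun t ht h => by have := hs t ht; omega
      _ = ∑ t, (if (t.2.1 : ℕ) = 2 then P t else 0) := by rw [hb2, hb5]
      _ ≤ _ := hP.sum_ite_le fun t ht h => by have := hs t ht; omega
end

section
/- For every λ ≥ 0.003, define f_λ(r) := 1 − exp(−λ·r) and the Bell regret utility ũ(d; y₀, y₁) := y_d + f_λ(y_d − y_{1−d}) for d ∈ {0,1}. Let P₁ be the lottery on ℝ × ℝ with P₁(4000, 3000) = 0.8 and P₁(0, 3000) = 0.2, and let P₂ be the lottery with P₂(4000, 3000) = 0.05, P₂(4000, 0) = 0.15, P₂(0, 3000) = 0.2, P₂(0, 0) = 0.6. Define V_P(d) := E_P[ũ(d; y₀, y₁)]. Then V_{P₁}(1) > V_{P₁}(0) > V_{P₂}(0) > V_{P₂}(1). (This ranking matches the Allais choice pattern b₁ ≻ a₁ ≻ a₂ ≻ b₂.) -/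
/-- Bell's rejoicing/regret function `f_λ(r) = 1 - exp(-λ r)`. -/
noncomputable def fBell (lam r : ℝ) : ℝ := 1 - Real.exp (-(lam * r))

/-- Bell's regret utility `ũ(d; y₀, y₁) = y_d + f_λ(y_d - y_{1-d})` for `d ∈ {0, 1}`. -/
noncomputable def uBell (lam : ℝ) (d : Fin 2) (z : ℝ × ℝ) : ℝ :=
  if d = 0 then z.1 + fBell lam (z.1 - z.2) else z.2 + fBell lam (z.2 - z.1)

/-- The common support of the two Allais couplings. -/
noncomputable def allaisSupp : Finset (ℝ × ℝ) :=
  {(4000, 3000), (4000, 0), (0, 3000), (0, 0)}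

/-- First-experiment coupling: `P₁(4000, 3000) = 0.8`, `P₁(0, 3000) = 0.2`. -/
noncomputable def allaisP1 : ℝ × ℝ → ℝ := fun z =>
  if z = (4000, 3000) then 0.8 else if z = (0, 3000) then 0.2 else 0

/-- Second-experiment coupling: `P₂(4000, 3000) = 0.05`, `P₂(4000, 0) = 0.15`,
`P₂(0, 3000) = 0.2`, `P₂(0, 0) = 0.6`. -/
noncomputable def allaisP2 : ℝ × ℝ → ℝ := fun z =>
  if z = (4000, 3000) then 0.05 else if z = (4000, 0) then 0.15 else
  if z = (0, 3000) then 0.2 else if z = (0, 0) then 0.6 else 0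

/-- Expected Bell utility `V_P(d) = E_P[ũ(d; y₀, y₁)]`. -/
noncomputable def VBell (lam : ℝ) (P : ℝ × ℝ → ℝ) (d : Fin 2) : ℝ :=
  ∑ z ∈ allaisSupp, uBell lam d z * P z

theorem sum_allaisSupp (g : ℝ × ℝ → ℝ) :
    ∑ z ∈ allaisSupp, g z = g (4000, 3000) + g (4000, 0) + g (0, 3000) + g (0, 0) := by
  unfold allaisSupp
  rw [Finset.sum_insert (by norm_num), Finset.sum_insert (by norm_num),
    Finset.sum_insert (by norm_num), Finset.sum_singleton]
  ring

theorem fBell_zero_right (lam : ℝ) : fBell lam 0 = 0 := by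
  simp [fBell]

theorem fBell_nat_mul (lam : ℝ) (n : ℕ) :
    fBell lam (1000 * n) = 1 - Real.exp (-(1000 * lam)) ^ n := by
  rw [fBell, ← Real.exp_nat_mul]
  ring_nf

theorem fBell_neg_nat_mul (lam : ℝ) (n : ℕ) :
    fBell lam (-(1000 * n)) = 1 - Real.exp (1000 * lam) ^ n := by
  rw [fBell, ← Real.exp_nat_mul]
  ring_nf

theorem twenty_lt_exp_three : (20 : ℝ) < Real.exp 3 := by
  have h : Real.exp 3 = Real.exp 1 ^ 3 := by
    rw [← Real.exp_nat_mul]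
    norm_num
  have h1 : (2.718 : ℝ) ^ 3 ≤ Real.exp 1 ^ 3 := by
    gcongr
    linarith [Real.exp_one_gt_d9]
  rw [h]
  norm_num at h1 ⊢
  linarith

/-- For every `λ ≥ 0.003`, Bell's regret utility ranks the Allais options as
`V_{P₁}(1) > V_{P₁}(0) > V_{P₂}(0) > V_{P₂}(1)`, matching the observed choice pattern
`b₁ ≻ a₁ ≻ a₂ ≻ b₂`. -/
theorem bell_resolves_allais (lam : ℝ) (hlam : lam ≥ 0.003) :
    VBell lam allaisP1 1 > VBell lam allaisP1 0 ∧
    VBell lam allaisP1 0 > VBell lam allaisP2 0 ∧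
    VBell lam allaisP2 0 > VBell lam allaisP2 1 := by
  have ht : 20 < Real.exp (1000 * lam) :=
    twenty_lt_exp_three.trans_le (Real.exp_le_exp.2 (by norm_num at hlam; linarith))
  have hs0 : 0 < Real.exp (-(1000 * lam)) := Real.exp_pos _
  have hs1 : Real.exp (-(1000 * lam)) ≤ 1 := Real.exp_le_one_iff.2 (by norm_num at hlam; linarith)
  have f1 := fBell_nat_mul lam 1
  have f3 := fBell_nat_mul lam 3
  have f4 := fBell_nat_mul lam 4
  have g1 := fBell_neg_nat_mul lam 1
  have g3 := fBell_neg_nat_mul lam 3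
  have g4 := fBell_neg_nat_mul lam 4
  norm_num at f1 f3 f4 g1 g3 g4
  simp only [VBell, sum_allaisSupp]
  norm_num [uBell, allaisP1, allaisP2, f1, f3, f4, g1, g3, g4, fBell_zero_right]
  generalize Real.exp (1000 * lam) = t at *
  generalize Real.exp (-(1000 * lam)) = s at *
  have hs3 : s ^ 3 ≤ 1 := pow_le_one₀ hs0.le hs1
  have hs4 : s ^ 4 ≤ 1 := pow_le_one₀ hs0.le hs1
  have hs3' : 0 < s ^ 3 := by positivity
  have hs4' : 0 < s ^ 4 := by positivity
  have ht2 : 400 < t ^ 2 := by nlinarith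
  have ht3 : 400 * t < t ^ 3 := by nlinarith
  have ht4 : 20 * t ^ 3 < t ^ 4 := by nlinarith
  refine ⟨?_, ?_, ?_⟩ <;> linarith
end
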